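/- If A and B are one-generated free algebras (tensor algebras on finite-dimensional spaces concentrated in degree 1) and τ: B⊗A → A⊗B is a graded twisting map such that the twisted tensor product A⊗_τB is quadratic, then A⊗_τB is a Koszul algebra. -/

import Mathlib

open TensorProduct

noncomputable section

namespace TTP

variable (𝕜 : Type) [Field 𝕜]

/-- The image of `p ⊗ q` inside `M ⊗[𝕜] N`, for submodules `p ⊆ M`, `q ⊆ N`. -/
def subTmul {M N : Type} [AddCommGroup M] [Module 𝕜 M] [AddCommGroup N] [Module 𝕜 N]
    (p : Submodule 𝕜 M) (q : Submodule 𝕜 N) : Submodule 𝕜 (M ⊗[𝕜] N) :=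
  LinearMap.range (TensorProduct.map p.subtype q.subtype)

/-- The Künneth grading on a tensor product of graded vector spaces. -/
def kunneth {M N : Type} [AddCommGroup M] [Module 𝕜 M] [AddCommGroup N] [Module 𝕜 N]
    (𝒜 : ℕ → Submodule 𝕜 M) (ℬ : ℕ → Submodule 𝕜 N) (n : ℕ) : Submodule 𝕜 (M ⊗[𝕜] N) :=
  ⨆ (pq : ℕ × ℕ) (_ : pq.1 + pq.2 = n), subTmul 𝕜 (𝒜 pq.1) (ℬ pq.2)

/-- The positive part `X₊ = ⊕_{i>0} X_i` of a graded vector space. -/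
def plusPart {M : Type} [AddCommGroup M] [Module 𝕜 M] (𝒜 : ℕ → Submodule 𝕜 M) :
    Submodule 𝕜 M :=
  ⨆ (i : ℕ) (_ : 0 < i), 𝒜 i

/-- The grading concentrating `𝒜 1` in degree `1` (and `⊥` elsewhere). -/
def degOne {M : Type} [AddCommGroup M] [Module 𝕜 M] (𝒜 : ℕ → Submodule 𝕜 M) :
    ℕ → Submodule 𝕜 M :=
  fun n => if n = 1 then 𝒜 1 else ⊥

variable (A B : Type) [Ring A] [Algebra 𝕜 A] [Ring B] [Algebra 𝕜 B]

/-- `τ ∘ (μ_B ⊗ μ_A)` on `(B ⊗ B) ⊗ (A ⊗ A)`. -/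
def twistLHS (τ : B ⊗[𝕜] A →ₗ[𝕜] A ⊗[𝕜] B) :
    (B ⊗[𝕜] B) ⊗[𝕜] (A ⊗[𝕜] A) →ₗ[𝕜] A ⊗[𝕜] B :=
  τ ∘ₗ TensorProduct.map (LinearMap.mul' 𝕜 B) (LinearMap.mul' 𝕜 A)

/-- `(μ_A ⊗ μ_B) ∘ (1_A ⊗ τ ⊗ 1_B) ∘ (τ ⊗ τ) ∘ (1_B ⊗ τ ⊗ 1_A)` on `(B ⊗ B) ⊗ (A ⊗ A)`. -/
def twistRHS (τ : B ⊗[𝕜] A →ₗ[𝕜] A ⊗[𝕜] B) :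
    (B ⊗[𝕜] B) ⊗[𝕜] (A ⊗[𝕜] A) →ₗ[𝕜] A ⊗[𝕜] B :=
  TensorProduct.map (LinearMap.mul' 𝕜 A) (LinearMap.mul' 𝕜 B)
    ∘ₗ (TensorProduct.assoc 𝕜 A A (B ⊗[𝕜] B)).symm.toLinearMap
    ∘ₗ LinearMap.lTensor A (TensorProduct.assoc 𝕜 A B B).toLinearMap
    ∘ₗ LinearMap.lTensor A (LinearMap.rTensor B τ)
    ∘ₗ LinearMap.lTensor A (TensorProduct.assoc 𝕜 B A B).symm.toLinearMap
    ∘ₗ (TensorProduct.assoc 𝕜 A B (A ⊗[𝕜] B)).toLinearMap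
    ∘ₗ TensorProduct.map τ τ
    ∘ₗ (TensorProduct.assoc 𝕜 B A (B ⊗[𝕜] A)).symm.toLinearMap
    ∘ₗ LinearMap.lTensor B (TensorProduct.assoc 𝕜 A B A).toLinearMap
    ∘ₗ LinearMap.lTensor B (LinearMap.rTensor A τ)
    ∘ₗ LinearMap.lTensor B (TensorProduct.assoc 𝕜 B A A).symm.toLinearMap
    ∘ₗ (TensorProduct.assoc 𝕜 B B (A ⊗[𝕜] A)).toLinearMap

/-- `τ : B ⊗ A → A ⊗ B` is an (algebra) twisting map: it satisfies the unital twisting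
conditions and `τ(μ_B ⊗ μ_A) = (μ_A ⊗ μ_B)(1_A ⊗ τ ⊗ 1_B)(τ ⊗ τ)(1_B ⊗ τ ⊗ 1_A)`. -/
def IsTwisting (τ : B ⊗[𝕜] A →ₗ[𝕜] A ⊗[𝕜] B) : Prop :=
  (∀ a : A, τ ((1 : B) ⊗ₜ[𝕜] a) = a ⊗ₜ[𝕜] (1 : B)) ∧
  (∀ b : B, τ (b ⊗ₜ[𝕜] (1 : A)) = (1 : A) ⊗ₜ[𝕜] b) ∧
  twistLHS 𝕜 A B τ = twistRHS 𝕜 A B τ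

/-- `τ` preserves the Künneth grading. -/
def IsGradedMapBA (𝒜 : ℕ → Submodule 𝕜 A) (ℬ : ℕ → Submodule 𝕜 B)
    (τ : B ⊗[𝕜] A →ₗ[𝕜] A ⊗[𝕜] B) : Prop :=
  ∀ n, Submodule.map τ (kunneth 𝕜 ℬ 𝒜 n) ≤ kunneth 𝕜 𝒜 ℬ n

/-- `τ` is a graded twisting map. -/
def IsGradedTwisting (𝒜 : ℕ → Submodule 𝕜 A) (ℬ : ℕ → Submodule 𝕜 B)
    (τ : B ⊗[𝕜] A →ₗ[𝕜] A ⊗[𝕜] B) : Prop :=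
  IsTwisting 𝕜 A B τ ∧ IsGradedMapBA 𝕜 A B 𝒜 ℬ τ

/-- A graded linear map `τ` is graded twisting to degree `n`:  it satisfies the unital
conditions and the twisting identity in all (Künneth) degrees `≤ n`. -/
def TwistingToDeg (𝒜 : ℕ → Submodule 𝕜 A) (ℬ : ℕ → Submodule 𝕜 B)
    (τ : B ⊗[𝕜] A →ₗ[𝕜] A ⊗[𝕜] B) (n : ℕ) : Prop :=
  IsGradedMapBA 𝕜 A B 𝒜 ℬ τ ∧
  (∀ j ≤ n, ∀ a ∈ 𝒜 j, τ ((1 : B) ⊗ₜ[𝕜] a) = a ⊗ₜ[𝕜] (1 : B)) ∧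
  (∀ j ≤ n, ∀ b ∈ ℬ j, τ (b ⊗ₜ[𝕜] (1 : A)) = (1 : A) ⊗ₜ[𝕜] b) ∧
  (∀ j ≤ n, ∀ x ∈ kunneth 𝕜 (kunneth 𝕜 ℬ ℬ) (kunneth 𝕜 𝒜 𝒜) j,
    twistLHS 𝕜 A B τ x = twistRHS 𝕜 A B τ x)

/-- The unique extension property of a graded twisting map:  for every `n ≥ 3`, any
linear map `τ'` that is graded twisting to degree `n` and agrees with `τ` in all degrees
`< n` also agrees with `τ` in degree `n`. -/
def UEP (𝒜 : ℕ → Submodule 𝕜 A) (ℬ : ℕ → Submodule 𝕜 B)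
    (τ : B ⊗[𝕜] A →ₗ[𝕜] A ⊗[𝕜] B) : Prop :=
  ∀ n, 3 ≤ n → ∀ τ' : B ⊗[𝕜] A →ₗ[𝕜] A ⊗[𝕜] B,
    TwistingToDeg 𝕜 A B 𝒜 ℬ τ' n →
    (∀ i < n, ∀ x ∈ kunneth 𝕜 ℬ 𝒜 i, τ' x = τ x) →
    ∀ x ∈ kunneth 𝕜 ℬ 𝒜 n, τ' x = τ x

/-- The multiplication `μ_τ = (μ_A ⊗ μ_B)(1_A ⊗ τ ⊗ 1_B)` on `A ⊗ B`. -/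
def mulTau (τ : B ⊗[𝕜] A →ₗ[𝕜] A ⊗[𝕜] B) :
    (A ⊗[𝕜] B) ⊗[𝕜] (A ⊗[𝕜] B) →ₗ[𝕜] A ⊗[𝕜] B :=
  TensorProduct.map (LinearMap.mul' 𝕜 A) (LinearMap.mul' 𝕜 B)
    ∘ₗ (TensorProduct.assoc 𝕜 A A (B ⊗[𝕜] B)).symm.toLinearMap
    ∘ₗ LinearMap.lTensor A (TensorProduct.assoc 𝕜 A B B).toLinearMap
    ∘ₗ LinearMap.lTensor A (LinearMap.rTensor B τ)
    ∘ₗ LinearMap.lTensor A (TensorProduct.assoc 𝕜 B A B).symm.toLinearMap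
    ∘ₗ (TensorProduct.assoc 𝕜 A B (A ⊗[𝕜] B)).toLinearMap

/-- `(C, ψ)` realizes the twisted tensor product algebra `A ⊗_τ B`:  `ψ` is a linear
isomorphism carrying the multiplication `μ_τ` and its unit to those of `C`. -/
def Realizes (τ : B ⊗[𝕜] A →ₗ[𝕜] A ⊗[𝕜] B) (C : Type) [Ring C] [Algebra 𝕜 C]
    (ψ : A ⊗[𝕜] B →ₗ[𝕜] C) : Prop :=
  Function.Bijective ψ ∧ ψ ((1 : A) ⊗ₜ[𝕜] (1 : B)) = 1 ∧
  ∀ x y : A ⊗[𝕜] B, ψ (mulTau 𝕜 A B τ (x ⊗ₜ[𝕜] y)) = ψ x * ψ y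

/-- The two-sided ideal generated by a subset, as a `𝕜`-submodule. -/
def idealSpan (C : Type) [Ring C] [Algebra 𝕜 C] (s : Set C) : Submodule 𝕜 C :=
  Submodule.span 𝕜 {x | ∃ c d r, r ∈ s ∧ x = c * r * d}

/-- Weight grading of the tensor algebra. -/
def tensorWeight (V : Type) [AddCommGroup V] [Module 𝕜 V] (n : ℕ) :
    Submodule 𝕜 (TensorAlgebra 𝕜 V) :=
  LinearMap.range (TensorAlgebra.ι 𝕜 (M := V)) ^ n

instance (V : Type) [AddCommGroup V] [Module 𝕜 V] : GradedAlgebra (tensorWeight 𝕜 V) :=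
  inferInstanceAs (GradedAlgebra
    ((LinearMap.range (TensorAlgebra.ι 𝕜 : V →ₗ[𝕜] TensorAlgebra 𝕜 V) ^ ·) : ℕ → Submodule 𝕜 _))

/-- The canonical map `T(C₁) → C` for a graded algebra `C`. -/
def canMap (C : Type) [Ring C] [Algebra 𝕜 C] (𝒞 : ℕ → Submodule 𝕜 C) :
    TensorAlgebra 𝕜 ↥(𝒞 1) →ₐ[𝕜] C :=
  TensorAlgebra.lift 𝕜 (𝒞 1).subtype

/-- `C` (with grading `𝒞`) is a quadratic algebra: the canonical map `T(C₁) → C` is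
surjective and its kernel is generated, as a two-sided ideal, by its degree 2 part. -/
def IsQuadraticAlg (C : Type) [Ring C] [Algebra 𝕜 C] (𝒞 : ℕ → Submodule 𝕜 C) : Prop :=
  Function.Surjective (canMap 𝕜 C 𝒞) ∧
  LinearMap.ker (canMap 𝕜 C 𝒞).toLinearMap =
    idealSpan 𝕜 (TensorAlgebra 𝕜 ↥(𝒞 1))
      ((LinearMap.ker (canMap 𝕜 C 𝒞).toLinearMap ⊓ tensorWeight 𝕜 ↥(𝒞 1) 2 : Submodule 𝕜 _) : Set _)

/-- The left ideal generated by the positive part of a graded algebra. -/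
def augIdeal (C : Type) [Ring C] [Algebra 𝕜 C] (𝒞 : ℕ → Submodule 𝕜 C) : Submodule C C :=
  Submodule.span C {x : C | ∃ i, 0 < i ∧ x ∈ 𝒞 i}

/-- The degree `n` component of the graded free module on generators `σ` in degree `i`. -/
def freeGrade (C : Type) [Ring C] [Algebra 𝕜 C] (𝒞 : ℕ → Submodule 𝕜 C)
    (i : ℕ) (σ : Type) (n : ℕ) : Submodule 𝕜 (σ →₀ C) :=
  ⨅ (j : σ), Submodule.comap (Finsupp.lapply j : (σ →₀ C) →ₗ[𝕜] C)
    (if i ≤ n then 𝒞 (n - i) else ⊥)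

/-- `C` (with grading `𝒞`) is a Koszul algebra: the trivial module `𝕜 = C/C₊` admits a
resolution by graded free modules with the `i`-th term generated in degree `i`. -/
def IsKoszul (C : Type) [Ring C] [Algebra 𝕜 C] (𝒞 : ℕ → Submodule 𝕜 C) : Prop :=
  ∃ (σ : ℕ → Type) (d : ∀ i : ℕ, ((σ (i + 1)) →₀ C) →ₗ[C] ((σ i) →₀ C))
    (ε : ((σ 0) →₀ C) →ₗ[C] (C ⧸ augIdeal 𝕜 C 𝒞)),
    Function.Surjective ε ∧
    LinearMap.ker ε = LinearMap.range (d 0) ∧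
    (∀ i, LinearMap.ker (d i) = LinearMap.range (d (i + 1))) ∧
    (∀ i n, ∀ x ∈ freeGrade 𝕜 C 𝒞 (i + 1) (σ (i + 1)) n, d i x ∈ freeGrade 𝕜 C 𝒞 i (σ i) n) ∧
    (∀ n, 0 < n → ∀ x ∈ freeGrade 𝕜 C 𝒞 0 (σ 0) n, ε x = 0)

/-- `(P, ιA, ιB)` is a free product (coproduct) of `A` and `B`. -/
def IsFreeProduct (P : Type) [Ring P] [Algebra 𝕜 P] (ιA : A →ₐ[𝕜] P) (ιB : B →ₐ[𝕜] P) :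
    Prop :=
  ∀ (C : Type) [Ring C] [Algebra 𝕜 C], ∀ (f : A →ₐ[𝕜] C) (g : B →ₐ[𝕜] C),
    ∃! h : P →ₐ[𝕜] C, h.comp ιA = f ∧ h.comp ιB = g

/-- The linear map `A ⊗ B → P`, `a ⊗ b ↦ ιA(a) · ιB(b)`. -/
def mulMapP (P : Type) [Ring P] [Algebra 𝕜 P] (ιA : A →ₐ[𝕜] P) (ιB : B →ₐ[𝕜] P) :
    A ⊗[𝕜] B →ₗ[𝕜] P :=
  TensorProduct.lift (LinearMap.mk₂ 𝕜 (fun a b => ιA a * ιB b)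
    (fun a a' b => by simp [map_add, add_mul])
    (fun c a b => by simp [map_smul, smul_mul_assoc])
    (fun a b b' => by simp [map_add, mul_add])
    (fun c a b => by simp [map_smul, mul_smul_comm]))

/-- The set of `τ`-relations `b ⊗ a - τ(b ⊗ a)` of total degree at most `n`,
inside the free product `P`. -/
def relSetLe (P : Type) [Ring P] [Algebra 𝕜 P] (ιA : A →ₐ[𝕜] P) (ιB : B →ₐ[𝕜] P)
    (𝒜 : ℕ → Submodule 𝕜 A) (ℬ : ℕ → Submodule 𝕜 B)
    (τ : B ⊗[𝕜] A →ₗ[𝕜] A ⊗[𝕜] B) (n : ℕ) : Set P :=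
  {x | ∃ i j a b, i + j ≤ n ∧ a ∈ 𝒜 i ∧ b ∈ ℬ j ∧
    x = ιB b * ιA a - mulMapP 𝕜 A B P ιA ιB (τ (b ⊗ₜ[𝕜] a))}

/-- The set of all `τ`-relations `b ⊗ a - τ(b ⊗ a)` inside the free product `P`. -/
def relSetAll (P : Type) [Ring P] [Algebra 𝕜 P] (ιA : A →ₐ[𝕜] P) (ιB : B →ₐ[𝕜] P)
    (τ : B ⊗[𝕜] A →ₗ[𝕜] A ⊗[𝕜] B) : Set P :=
  {x | ∃ a b, x = ιB b * ιA a - mulMapP 𝕜 A B P ιA ιB (τ (b ⊗ₜ[𝕜] a))}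

/-- The (Künneth) grading on the free product `P` of the graded algebras `A` and `B`. -/
def freeProdGrade (P : Type) [Ring P] [Algebra 𝕜 P] (ιA : A →ₐ[𝕜] P) (ιB : B →ₐ[𝕜] P)
    (𝒜 : ℕ → Submodule 𝕜 A) (ℬ : ℕ → Submodule 𝕜 B) (n : ℕ) : Submodule 𝕜 P :=
  ⨆ (l : List ℕ) (_ : l.sum = n),
    ((l.map (fun i => Submodule.map ιA.toLinearMap (𝒜 i) ⊔ Submodule.map ιB.toLinearMap (ℬ i))).foldr
      (· * ·) 1)

end TTP

namespace TTP

open Module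

section NormalWords

theorem injective_of_surjective_of_projections {𝕜 M : Type} [Field 𝕜] [AddCommGroup M]
    [Module 𝕜 M] (P : ℕ → M →ₗ[𝕜] M)
    (hfin : ∀ n, FiniteDimensional 𝕜 (LinearMap.range (P n)))
    (hP : ∀ x, (∀ n, P n x = 0) → x = 0) (Φ : M →ₗ[𝕜] M)
    (hcomm : ∀ n x, Φ (P n x) = P n (Φ x)) (hsurj : Function.Surjective Φ) :
    Function.Injective Φ := by
  rw [injective_iff_map_eq_zero]
  intro x hx
  refine hP x fun n => ?_
  have hmaps : ∀ y ∈ LinearMap.range (P n), Φ y ∈ LinearMap.range (P n) := by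
    rintro _ ⟨y, rfl⟩
    exact ⟨Φ y, (hcomm n y).symm⟩
  have hres : Function.Surjective (Φ.restrict hmaps) := by
    rintro ⟨_, ⟨y, rfl⟩⟩
    obtain ⟨z, rfl⟩ := hsurj y
    exact ⟨⟨P n z, z, rfl⟩, Subtype.ext (hcomm n z)⟩
  have hinj := LinearMap.injective_iff_surjective.mpr hres
  have := @hinj ⟨P n x, x, rfl⟩ 0 (by
    rw [map_zero]
    refine Subtype.ext ?_
    change Φ (P n x) = 0
    rw [hcomm, hx, map_zero])
  exact congrArg Subtype.val this

variable {𝕜 : Type} [Field 𝕜] {X Y : Type} {C : Type} [Ring C] [Algebra 𝕜 C]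

/-- The span of the basis elements indexed by pairs of words of total length `n`. -/
def wordGrade (β : Basis (List X × List Y) 𝕜 C) (n : ℕ) : Submodule 𝕜 C :=
  Submodule.span 𝕜 (β '' {s | s.1.length + s.2.length = n})

/-- The generator of `C` attached to a letter. -/
def letterGen (β : Basis (List X × List Y) 𝕜 C) : X ⊕ Y → C
  | Sum.inl v => β ([v], [])
  | Sum.inr w => β ([], [w])

/-- `C` has a basis of normal words `p q`, with `p` a word in `X` and `q` a word in `Y` (both
written from right to left), that is compatible with multiplication by letters on the right. -/
structure IsNormalWordBasis (β : Basis (List X × List Y) 𝕜 C) : Prop where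
  nil : β ([], []) = 1
  mul_inr : ∀ p q w, β (p, q) * letterGen β (Sum.inr w) = β (p, w :: q)
  mul_inl : ∀ p v, β (p, []) * letterGen β (Sum.inl v) = β (v :: p, [])
  mul_inl_mem : ∀ p q v,
    β (p, q) * letterGen β (Sum.inl v) ∈ wordGrade β (p.length + q.length + 1)

open Classical in
/-- Strip the last letter `w : Y` off a normal word. -/
def stripInr (β : Basis (List X × List Y) 𝕜 C) (w : Y) : C →ₗ[𝕜] C :=
  β.constr 𝕜 fun
    | (_, []) => 0
    | (p, w' :: q) => if w' = w then β (p, q) else 0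

open Classical in
/-- Strip the last letter `v : X` off a normal word without letters from `Y`. -/
def stripInl (β : Basis (List X × List Y) 𝕜 C) (v : X) : C →ₗ[𝕜] C :=
  β.constr 𝕜 fun
    | (v' :: p, []) => if v' = v then β (p, []) else 0
    | _ => 0

/-- The projection onto the span of the normal words of length `n`. -/
def gradeProj (β : Basis (List X × List Y) 𝕜 C) (n : ℕ) : C →ₗ[𝕜] C :=
  β.constr 𝕜 fun s => if s.1.length + s.2.length = n then β s else 0

variable (β : Basis (List X × List Y) 𝕜 C)

theorem stripInr_nil (w : Y) (p : List X) : stripInr β w (β (p, [])) = 0 := by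
  simp [stripInr, Basis.constr_basis]

open Classical in
theorem stripInr_cons (w w' : Y) (p : List X) (q : List Y) :
    stripInr β w (β (p, w' :: q)) = if w' = w then β (p, q) else 0 := by
  simp [stripInr, Basis.constr_basis]

open Classical in
theorem stripInl_cons (v v' : X) (p : List X) :
    stripInl β v (β (v' :: p, [])) = if v' = v then β (p, []) else 0 := by
  simp [stripInl, Basis.constr_basis]

theorem gradeProj_basis (n : ℕ) (s : List X × List Y) :
    gradeProj β n (β s) = if s.1.length + s.2.length = n then β s else 0 := by
  simp [gradeProj, Basis.constr_basis]

theorem basis_mem_wordGrade (s : List X × List Y) {n : ℕ} (h : s.1.length + s.2.length = n) :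
    β s ∈ wordGrade β n :=
  Submodule.subset_span ⟨s, h, rfl⟩

theorem wordGrade_induction {n : ℕ} {S : Submodule 𝕜 C}
    (h : ∀ p q, p.length + q.length = n → β (p, q) ∈ S) {c : C} (hc : c ∈ wordGrade β n) :
    c ∈ S := by
  refine (Submodule.span_le.mpr ?_ : wordGrade β n ≤ S) hc
  rintro _ ⟨⟨p, q⟩, hs, rfl⟩
  exact h p q hs

theorem gradeProj_of_mem {k : ℕ} (n : ℕ) {c : C} (hc : c ∈ wordGrade β k) :
    gradeProj β n c = if k = n then c else 0 := by
  have : c ∈ LinearMap.ker (gradeProj β n - (if k = n then LinearMap.id else 0)) := by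
    refine wordGrade_induction β (fun p q h => ?_) hc
    rw [LinearMap.mem_ker, LinearMap.sub_apply, gradeProj_basis, h]
    split_ifs <;> simp
  rw [LinearMap.mem_ker, LinearMap.sub_apply, sub_eq_zero] at this
  rw [this]
  split_ifs <;> simp

theorem gradeProj_comm {T : C →ₗ[𝕜] C} (hT : ∀ k, ∀ c ∈ wordGrade β k, T c ∈ wordGrade β k)
    (n : ℕ) (c : C) : T (gradeProj β n c) = gradeProj β n (T c) := by
  have : T ∘ₗ gradeProj β n = gradeProj β n ∘ₗ T := by
    refine β.ext fun s => ?_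
    rw [LinearMap.comp_apply, LinearMap.comp_apply, gradeProj_basis,
      gradeProj_of_mem β n (hT _ _ (basis_mem_wordGrade β s rfl))]
    split_ifs <;> simp
  exact LinearMap.congr_fun this c

theorem gradeProj_mem (n : ℕ) (c : C) : gradeProj β n c ∈ wordGrade β n := by
  have : LinearMap.range (gradeProj β n) ≤ wordGrade β n := by
    rw [gradeProj, Basis.constr_range, Submodule.span_le]
    rintro _ ⟨s, rfl⟩
    dsimp only
    split_ifs with h
    · exact basis_mem_wordGrade β s h
    · exact zero_mem _
  exact this ⟨c, rfl⟩

theorem eq_zero_of_gradeProj {c : C} (h : ∀ n, gradeProj β n c = 0) : c = 0 := by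
  refine β.ext_elem fun s => ?_
  have key : β.coord s ∘ₗ gradeProj β (s.1.length + s.2.length) = β.coord s := by
    refine β.ext fun t => ?_
    rw [LinearMap.comp_apply, gradeProj_basis]
    split_ifs with ht
    · rfl
    · have : t ≠ s := fun e => ht (by rw [e])
      simp [this]
  have := LinearMap.congr_fun key c
  rw [LinearMap.comp_apply, h, map_zero] at this
  simpa using this.symm

theorem finiteDimensional_wordGrade [Finite X] [Finite Y] (n : ℕ) :
    FiniteDimensional 𝕜 (wordGrade β n) := by
  refine FiniteDimensional.span_of_finite 𝕜 (Set.Finite.image _ ?_)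
  refine ((List.finite_length_le X n).prod (List.finite_length_le Y n)).subset ?_
  rintro ⟨p, q⟩ h
  simp only [Set.mem_ofPred_eq] at h
  constructor <;> simp only [Set.mem_ofPred_eq] <;> omega

theorem stripInr_mem {k : ℕ} (w : Y) {c : C} (hc : c ∈ wordGrade β (k + 1)) :
    stripInr β w c ∈ wordGrade β k := by
  rw [← Submodule.mem_comap]
  refine wordGrade_induction β (fun p q h => ?_) hc
  rw [Submodule.mem_comap]
  cases q with
  | nil => rw [stripInr_nil]; exact zero_mem _
  | cons w' q =>
    classical
    rw [stripInr_cons]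
    split_ifs
    · exact basis_mem_wordGrade β _ (by simp at h ⊢; omega)
    · exact zero_mem _

theorem letterGen_mem (j : X ⊕ Y) : letterGen β j ∈ wordGrade β 1 := by
  cases j <;> exact basis_mem_wordGrade β _ rfl

theorem wordGrade_one_le_span :
    wordGrade β 1 ≤ Submodule.span 𝕜 (Set.range (letterGen β)) := by
  intro c hc
  refine wordGrade_induction β (fun p q h => ?_) hc
  match p, q, h with
  | [v], [], _ => exact Submodule.subset_span ⟨Sum.inl v, rfl⟩
  | [], [w], _ => exact Submodule.subset_span ⟨Sum.inr w, rfl⟩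
  | [], [], h => simp at h
  | _ :: _ :: _, _, h => simp at h; omega
  | _ :: _, _ :: _, h => simp at h; omega
  | _, _ :: _ :: _, h => simp at h; omega

/-- The span of the normal words without letters from `Y`. -/
def inlPart : Submodule 𝕜 C := Submodule.span 𝕜 (Set.range fun p => β (p, []))

theorem basis_mem_inlPart (p : List X) : β (p, []) ∈ inlPart β :=
  Submodule.subset_span ⟨p, rfl⟩

theorem stripInr_of_mem_inlPart (w : Y) {c : C} (hc : c ∈ inlPart β) : stripInr β w c = 0 := by
  rw [← LinearMap.mem_ker]
  refine (Submodule.span_le.mpr ?_ : inlPart β ≤ _) hc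
  rintro _ ⟨p, rfl⟩
  exact stripInr_nil β w p

theorem mem_inlPart_of_stripInr {c : C} (hc : ∀ w, stripInr β w c = 0) : c ∈ inlPart β := by
  have key : ∀ p w q, β.coord (p, q) ∘ₗ stripInr β w = β.coord (p, w :: q) := by
    intro p w q
    classical
    refine β.ext ?_
    rintro ⟨p', _ | ⟨w', q'⟩⟩
    · rw [LinearMap.comp_apply, stripInr_nil]
      simp
    · rw [LinearMap.comp_apply, stripInr_cons]
      split_ifs with h
      · subst h
        simp [Finsupp.single_apply]
      · simp [h]
  have hmem : c ∈ Submodule.span 𝕜 (β '' Set.range fun p : List X => (p, ([] : List Y))) := by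
    rw [Basis.mem_span_image]
    rintro ⟨p, _ | ⟨w, q⟩⟩ hs
    · exact ⟨p, rfl⟩
    · exfalso
      have := LinearMap.congr_fun (key p w q) c
      rw [LinearMap.comp_apply, hc, map_zero] at this
      simp only [Finset.mem_coe, Finsupp.mem_support_iff] at hs
      exact hs this.symm
  rwa [← Set.range_comp] at hmem

variable {β}

namespace IsNormalWordBasis

variable (hβ : IsNormalWordBasis β)
include hβ

theorem mul_letterGen_mem {k : ℕ} {c : C} (hc : c ∈ wordGrade β k) (j : X ⊕ Y) :
    c * letterGen β j ∈ wordGrade β (k + 1) := by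
  have : c ∈ (wordGrade β (k + 1)).comap (LinearMap.mulRight 𝕜 (letterGen β j)) := by
    refine wordGrade_induction β (fun p q h => ?_) hc
    rw [Submodule.mem_comap, LinearMap.mulRight_apply]
    cases j with
    | inl v => exact h ▸ hβ.mul_inl_mem p q v
    | inr w =>
      rw [hβ.mul_inr]
      exact basis_mem_wordGrade β _ (by simp; omega)
  exact this

theorem mul_mem {k : ℕ} {c x : C} (hc : c ∈ wordGrade β k) (hx : x ∈ wordGrade β 1) :
    c * x ∈ wordGrade β (k + 1) := by
  have : x ∈ (wordGrade β (k + 1)).comap (LinearMap.mulLeft 𝕜 c) := by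
    refine (Submodule.span_le.mpr ?_) (wordGrade_one_le_span β hx)
    rintro _ ⟨j, rfl⟩
    exact hβ.mul_letterGen_mem hc j
  exact this

theorem one_mem : (1 : C) ∈ wordGrade β 0 :=
  hβ.nil ▸ basis_mem_wordGrade β _ rfl

open Classical in
theorem stripInr_mul (w w' : Y) (c : C) :
    stripInr β w (c * letterGen β (Sum.inr w')) = if w' = w then c else 0 := by
  have : stripInr β w ∘ₗ LinearMap.mulRight 𝕜 (letterGen β (Sum.inr w')) =
      if w' = w then LinearMap.id else 0 := by
    refine β.ext ?_
    rintro ⟨p, q⟩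
    rw [LinearMap.comp_apply, LinearMap.mulRight_apply, hβ.mul_inr, stripInr_cons]
    split_ifs <;> rfl
  have := LinearMap.congr_fun this c
  rw [LinearMap.comp_apply, LinearMap.mulRight_apply] at this
  rw [this]
  split_ifs <;> rfl

theorem inlPart_mul {c : C} (hc : c ∈ inlPart β) (v : X) :
    c * letterGen β (Sum.inl v) ∈ inlPart β := by
  have : c ∈ (inlPart β).comap (LinearMap.mulRight 𝕜 (letterGen β (Sum.inl v))) := by
    refine (Submodule.span_le.mpr ?_ : inlPart β ≤ _) hc
    rintro _ ⟨p, rfl⟩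
    change β (p, []) * letterGen β (Sum.inl v) ∈ inlPart β
    rw [hβ.mul_inl]
    exact basis_mem_inlPart β _
  exact this

open Classical in
theorem stripInl_mul (v v' : X) {c : C} (hc : c ∈ inlPart β) :
    stripInl β v (c * letterGen β (Sum.inl v')) = if v' = v then c else 0 := by
  have : c ∈ LinearMap.ker (stripInl β v ∘ₗ LinearMap.mulRight 𝕜 (letterGen β (Sum.inl v')) -
      (if v' = v then LinearMap.id else 0)) := by
    refine (Submodule.span_le.mpr ?_ : inlPart β ≤ _) hc
    rintro _ ⟨p, rfl⟩
    rw [SetLike.mem_coe, LinearMap.mem_ker, LinearMap.sub_apply, LinearMap.comp_apply,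
      LinearMap.mulRight_apply, hβ.mul_inl, stripInl_cons]
    split_ifs <;> simp
  rw [LinearMap.mem_ker, LinearMap.sub_apply, LinearMap.comp_apply, LinearMap.mulRight_apply,
    sub_eq_zero] at this
  rw [this]
  split_ifs <;> rfl

theorem wordGrade_zero {c : C} (hc : c ∈ wordGrade β 0) : ∃ t : 𝕜, c = t • (1 : C) := by
  have : c ∈ Submodule.span 𝕜 {(1 : C)} := by
    refine wordGrade_induction β (fun p q h => ?_) hc
    obtain ⟨rfl, rfl⟩ : p = [] ∧ q = [] := by simpa using h
    rw [hβ.nil]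
    exact Submodule.mem_span_singleton_self 1
  obtain ⟨t, rfl⟩ := Submodule.mem_span_singleton.mp this
  exact ⟨t, rfl⟩

end IsNormalWordBasis

theorem linearCombination_eq_sum {R M σ : Type} [Semiring R] [AddCommMonoid M] [Module R M]
    [Fintype σ] (v : σ → M) (f : σ →₀ R) :
    Finsupp.linearCombination R v f = ∑ i, f i • v i := by
  rw [Finsupp.linearCombination_apply, Finsupp.sum_fintype]
  exact fun i => zero_smul R (v i)

variable (β)

/-- Evaluate a family of coefficients on the letters. -/
def letterEval : (X ⊕ Y →₀ C) →ₗ[C] C := Finsupp.linearCombination C (letterGen β)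

@[simp]
theorem letterEval_single (j : X ⊕ Y) (c : C) :
    letterEval β (Finsupp.single j c) = c * letterGen β j := by
  simp [letterEval]

/-- The families whose coefficients at letters of `X` do not involve `Y`, with all
coefficients in `S`. -/
def normalFamilies (S : Submodule 𝕜 C) : Submodule 𝕜 (X ⊕ Y →₀ C) where
  carrier := {f | (∀ v, f (Sum.inl v) ∈ inlPart β) ∧ ∀ j, f j ∈ S}
  add_mem' := fun hf hg =>
    ⟨fun v => add_mem (hf.1 v) (hg.1 v), fun j => add_mem (hf.2 j) (hg.2 j)⟩
  zero_mem' := ⟨fun _ => zero_mem _, fun _ => zero_mem _⟩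
  smul_mem' := fun t _ hf =>
    ⟨fun v => Submodule.smul_mem _ t (hf.1 v), fun j => Submodule.smul_mem _ t (hf.2 j)⟩

theorem normalFamilies_mono {S S' : Submodule 𝕜 C} (h : S ≤ S') :
    normalFamilies β S ≤ normalFamilies β S' :=
  fun _ hf => ⟨hf.1, fun j => h (hf.2 j)⟩

variable {β}

namespace IsNormalWordBasis

variable (hβ : IsNormalWordBasis β)
include hβ

theorem wordGrade_succ_le (n : ℕ) :
    wordGrade β (n + 1) ≤ (normalFamilies β (wordGrade β n)).map
      ((letterEval β).restrictScalars 𝕜) := by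
  classical
  intro c hc
  refine wordGrade_induction β (fun p q h => ?_) hc
  match p, q, h with
  | p, w :: q, h =>
    refine ⟨Finsupp.single (Sum.inr w) (β (p, q)), ⟨fun v => ?_, fun j => ?_⟩, ?_⟩
    · rw [Finsupp.single_eq_of_ne (by simp)]
      exact zero_mem _
    · rw [Finsupp.single_apply]
      split_ifs
      · exact basis_mem_wordGrade β _ (by simp at h ⊢; omega)
      · exact zero_mem _
    · rw [LinearMap.restrictScalars_apply, letterEval_single, hβ.mul_inr]
  | v :: p, [], h =>
    refine ⟨Finsupp.single (Sum.inl v) (β (p, [])), ⟨fun v => ?_, fun j => ?_⟩, ?_⟩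
    · rw [Finsupp.single_apply]
      split_ifs
      · exact basis_mem_inlPart β _
      · exact zero_mem _
    · rw [Finsupp.single_apply]
      split_ifs
      · exact basis_mem_wordGrade β _ (by simpa using h)
      · exact zero_mem _
    · rw [LinearMap.restrictScalars_apply, letterEval_single, hβ.mul_inl]
  | [], [], h => simp at h

theorem exists_normalFamily (f : X ⊕ Y →₀ C) :
    ∃ g ∈ normalFamilies β ⊤, letterEval β g = letterEval β f := by
  suffices letterEval β f ∈ (normalFamilies β ⊤).map ((letterEval β).restrictScalars 𝕜) from this
  induction f using Finsupp.induction_linear with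
  | zero => rw [map_zero]; exact zero_mem _
  | add f g hf hg => rw [map_add]; exact add_mem hf hg
  | single j c =>
    rw [letterEval_single]
    have hc : c ∈ ((normalFamilies β ⊤).map ((letterEval β).restrictScalars 𝕜)).comap
        (LinearMap.mulRight 𝕜 (letterGen β j)) := by
      refine (Submodule.span_le.mpr ?_) (β.mem_span c)
      rintro _ ⟨s, rfl⟩
      exact Submodule.map_mono (normalFamilies_mono β le_top)
        (hβ.wordGrade_succ_le _ (hβ.mul_letterGen_mem (basis_mem_wordGrade β s rfl) j))
    exact hc

theorem normalFamily_eq_zero [Finite X] [Finite Y] {f : X ⊕ Y →₀ C}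
    (hf : ∀ v, f (Sum.inl v) ∈ inlPart β) (h : letterEval β f = 0) : f = 0 := by
  classical
  have := Fintype.ofFinite X
  have := Fintype.ofFinite Y
  rw [letterEval, linearCombination_eq_sum, Fintype.sum_sum_type] at h
  simp only [smul_eq_mul] at h
  have hr : ∀ w, f (Sum.inr w) = 0 := by
    intro w
    have h' := congrArg (stripInr β w) h
    rw [map_add, map_sum, map_sum, map_zero, Finset.sum_eq_zero, zero_add] at h'
    · simpa [hβ.stripInr_mul] using h'
    · exact fun v _ => stripInr_of_mem_inlPart β w (hβ.inlPart_mul (hf v) v)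
  have hl : ∀ v, f (Sum.inl v) = 0 := by
    intro v
    have h' := congrArg (stripInl β v) h
    simp only [hr, zero_mul, Finset.sum_const_zero, add_zero, map_sum, map_zero] at h'
    rw [Finset.sum_congr rfl fun v' _ => hβ.stripInl_mul v v' (hf v')] at h'
    simpa using h'
  ext (v | w)
  · exact hl v
  · exact hr w

open Classical in
theorem exists_relation (w : Y) (v : X) : ∃ r : X ⊕ Y →₀ C, letterEval β r = 0 ∧
    (∀ j, r j ∈ wordGrade β 1) ∧
    ∀ w' v', stripInr β w' (r (Sum.inl v')) = if (w, v) = (w', v') then 1 else 0 := by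
  obtain ⟨g, ⟨hg, hg'⟩, hgr⟩ := hβ.wordGrade_succ_le 1
    (hβ.mul_letterGen_mem (letterGen_mem β (Sum.inr w)) (Sum.inl v))
  rw [LinearMap.restrictScalars_apply] at hgr
  refine ⟨Finsupp.single (Sum.inl v) (letterGen β (Sum.inr w)) - g, ?_, fun j => ?_,
    fun w' v' => ?_⟩
  · rw [map_sub, letterEval_single, hgr, sub_self]
  · rw [Finsupp.sub_apply, Finsupp.single_apply]
    refine sub_mem ?_ (hg' j)
    split_ifs
    · exact letterGen_mem β _
    · exact zero_mem _
  · rw [Finsupp.sub_apply, map_sub, stripInr_of_mem_inlPart β w' (hg v'), sub_zero,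
      Finsupp.single_apply]
    have := hβ.stripInr_mul w' w 1
    rw [one_mul] at this
    by_cases hv : v = v'
    · subst hv
      simp [this]
    · simp [hv]

end IsNormalWordBasis

/-- A family of relations `r (w, v)`, one for each product of letters `w v`, expressing that
product through normal words of length two. -/
structure IsRelationFamily (β : Basis (List X × List Y) 𝕜 C) (r : Y × X → (X ⊕ Y →₀ C)) :
    Prop where
  letterEval_eq_zero : ∀ i, letterEval β (r i) = 0
  mem : ∀ i j, r i j ∈ wordGrade β 1
  strip_self : ∀ i, stripInr β i.1 (r i (Sum.inl i.2)) = 1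
  strip_of_ne : ∀ i i', i ≠ i' → stripInr β i'.1 (r i (Sum.inl i'.2)) = 0

variable {r : Y × X → (X ⊕ Y →₀ C)}

theorem IsNormalWordBasis.exists_isRelationFamily (hβ : IsNormalWordBasis β) :
    ∃ r, IsRelationFamily β r := by
  choose r h1 h2 h3 using hβ.exists_relation
  refine ⟨fun i => r i.1 i.2, fun i => h1 _ _, fun i => h2 _ _, fun i => ?_, fun i i' h => ?_⟩
  · rw [h3, if_pos rfl]
  · rw [h3, if_neg h]

theorem mem_span_relations_of_degree_one [Finite X] [Finite Y] (hβ : IsNormalWordBasis β)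
    (hr : IsRelationFamily β r) {f : X ⊕ Y →₀ C} (hf : ∀ j, f j ∈ wordGrade β 1)
    (h : letterEval β f = 0) : f ∈ Submodule.span C (Set.range r) := by
  classical
  have := Fintype.ofFinite X
  have := Fintype.ofFinite Y
  have hstrip : ∀ i : Y × X, ∃ t : 𝕜, stripInr β i.1 (f (Sum.inl i.2)) = t • (1 : C) :=
    fun i => hβ.wordGrade_zero (stripInr_mem β i.1 (hf _))
  choose t ht using hstrip
  have hmem : ∑ i, t i • r i ∈ Submodule.span C (Set.range r) := by
    refine Submodule.sum_mem _ fun i _ => ?_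
    rw [← algebraMap_smul C]
    exact Submodule.smul_mem _ _ (Submodule.subset_span ⟨i, rfl⟩)
  have hzero : f - ∑ i, t i • r i = 0 := by
    refine hβ.normalFamily_eq_zero (fun v => mem_inlPart_of_stripInr β fun w => ?_) ?_
    · rw [Finsupp.sub_apply, Finsupp.finsetSum_apply, map_sub, map_sum, ht (w, v),
        Finset.sum_eq_single (w, v), Finsupp.smul_apply, map_smul, hr.strip_self (w, v), sub_self]
      · intro i _ hi
        rw [Finsupp.smul_apply, map_smul, hr.strip_of_ne i (w, v) hi, smul_zero]
      · simp
    · rw [map_sub, map_sum, h, zero_sub, neg_eq_zero]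
      refine Finset.sum_eq_zero fun i _ => ?_
      rw [← algebraMap_smul C, map_smul, hr.letterEval_eq_zero, smul_zero]
  rw [sub_eq_zero] at hzero
  rwa [hzero]

/-- The coordinates of an element of degree one with respect to the letters. -/
def letterCoord (β : Basis (List X × List Y) 𝕜 C) : C →ₗ[𝕜] (X ⊕ Y →₀ C) :=
  β.constr 𝕜 fun
    | ([v], []) => Finsupp.single (Sum.inl v) 1
    | ([], [w]) => Finsupp.single (Sum.inr w) 1
    | _ => 0

theorem letterCoord_letterGen (β : Basis (List X × List Y) 𝕜 C) (j : X ⊕ Y) :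
    letterCoord β (letterGen β j) = Finsupp.single j 1 := by
  cases j <;> simp [letterCoord, letterGen, Basis.constr_basis]

theorem letterEval_letterCoord (β : Basis (List X × List Y) 𝕜 C) {x : C}
    (hx : x ∈ wordGrade β 1) : letterEval β (letterCoord β x) = x := by
  have : x ∈ LinearMap.ker
      ((letterEval β).restrictScalars 𝕜 ∘ₗ letterCoord β - LinearMap.id) := by
    refine (Submodule.span_le.mpr ?_) (wordGrade_one_le_span β hx)
    rintro _ ⟨j, rfl⟩
    rw [SetLike.mem_coe, LinearMap.mem_ker]
    simp [letterCoord_letterGen]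
  rw [LinearMap.mem_ker] at this
  simpa [sub_eq_zero] using this

theorem letterCoord_mem (hβ : IsNormalWordBasis β) {x : C} (hx : x ∈ wordGrade β 1)
    (j : X ⊕ Y) : letterCoord β x j ∈ wordGrade β 0 := by
  classical
  have : x ∈ (wordGrade β 0).comap (Finsupp.lapply j ∘ₗ letterCoord β) := by
    refine (Submodule.span_le.mpr ?_) (wordGrade_one_le_span β hx)
    rintro _ ⟨i, rfl⟩
    change letterCoord β (letterGen β i) j ∈ wordGrade β 0
    rw [letterCoord_letterGen, Finsupp.single_apply]
    split_ifs
    · exact hβ.one_mem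
    · exact zero_mem _
  exact this

/-- The action of the tensor algebra on `F ⊕ 𝕜`, where `F` is the free module on the letters,
for which `x` of degree one sends `(f, t)` to `(x f + t [x], 0)`. -/
def derivAction (β : Basis (List X × List Y) 𝕜 C) :
    TensorAlgebra 𝕜 (wordGrade β 1) →ₐ[𝕜] Module.End 𝕜 ((X ⊕ Y →₀ C) × 𝕜) :=
  TensorAlgebra.lift 𝕜 (LinearMap.mk₂ 𝕜
    (fun (x : wordGrade β 1) (z : (X ⊕ Y →₀ C) × 𝕜) =>
      ((x.1 • z.1 + z.2 • letterCoord β x.1, 0) : (X ⊕ Y →₀ C) × 𝕜))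
    (fun x y z => by simp [add_smul, smul_add, add_add_add_comm])
    (fun t x z => by simp [smul_add, smul_comm t z.2])
    (fun x z z' => by simp [add_smul, smul_add, add_add_add_comm])
    (fun t x z => by simp [smul_add, smul_smul, smul_comm t x.1]))

theorem derivAction_ι (x : wordGrade β 1) (z : (X ⊕ Y →₀ C) × 𝕜) :
    derivAction β (TensorAlgebra.ι 𝕜 x) z = (x.1 • z.1 + z.2 • letterCoord β x.1, 0) := by
  simp [derivAction]

theorem derivAction_left (t : TensorAlgebra 𝕜 (wordGrade β 1)) :
    ∀ f, derivAction β t (f, 0) = (canMap 𝕜 C (wordGrade β) t • f, 0) := by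
  induction t using TensorAlgebra.induction with
  | algebraMap c => intro f; simp [Module.algebraMap_end_apply]
  | ι x => intro f; rw [derivAction_ι]; simp [canMap]
  | mul a b ha hb => intro f; rw [map_mul, Module.End.mul_apply, hb, ha, map_mul, mul_smul]
  | add a b ha hb =>
    intro f
    rw [map_add, LinearMap.add_apply, ha, hb, map_add, add_smul, Prod.mk_add_mk, add_zero]

theorem derivAction_apply (t : TensorAlgebra 𝕜 (wordGrade β 1)) (f : X ⊕ Y →₀ C) (c : 𝕜) :
    derivAction β t (f, c) =
      (canMap 𝕜 C (wordGrade β) t • f, 0) + c • derivAction β t (0, 1) := by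
  rw [← derivAction_left, ← map_smul, ← map_add]
  simp

theorem derivAction_degree_two (hβ : IsNormalWordBasis β)
    {t : TensorAlgebra 𝕜 (wordGrade β 1)} (ht : t ∈ tensorWeight 𝕜 (wordGrade β 1) 2) :
    ∃ f, derivAction β t (0, 1) = (f, 0) ∧ (∀ j, f j ∈ wordGrade β 1) ∧
      letterEval β f = canMap 𝕜 C (wordGrade β) t := by
  rw [tensorWeight, pow_two] at ht
  induction ht using Submodule.mul_induction_on' with
  | mem_mul_mem m hm n hn =>
    obtain ⟨x, rfl⟩ := hm
    obtain ⟨y, rfl⟩ := hn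
    refine ⟨x.1 • letterCoord β y.1, ?_, fun j => ?_, ?_⟩
    · rw [map_mul, Module.End.mul_apply, derivAction_ι, derivAction_ι]
      simp
    · rw [Finsupp.smul_apply, smul_eq_mul]
      obtain ⟨c, hc⟩ := hβ.wordGrade_zero (letterCoord_mem hβ y.2 j)
      rw [hc, mul_smul_comm, mul_one]
      exact Submodule.smul_mem _ _ x.2
    · rw [map_smul, letterEval_letterCoord β y.2]
      simp [canMap]
  | add m _ n _ hm hn =>
    obtain ⟨f, h1, h2, h3⟩ := hm
    obtain ⟨g, h4, h5, h6⟩ := hn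
    refine ⟨f + g, ?_, fun j => add_mem (h2 j) (h5 j), ?_⟩
    · rw [map_add, LinearMap.add_apply, h1, h4]
      simp
    · rw [map_add, map_add, h3, h6]

theorem mem_span_relations [Finite X] [Finite Y] (hβ : IsNormalWordBasis β)
    (hr : IsRelationFamily β r) (hq : IsQuadraticAlg 𝕜 C (wordGrade β)) {f : X ⊕ Y →₀ C}
    (h : letterEval β f = 0) : f ∈ Submodule.span C (Set.range r) := by
  classical
  have := Fintype.ofFinite X
  have := Fintype.ofFinite Y
  obtain ⟨hsurj, hker⟩ := hq
  choose lift hlift using hsurj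
  set x : X ⊕ Y → wordGrade β 1 := fun j => ⟨letterGen β j, letterGen_mem β j⟩
  set t : TensorAlgebra 𝕜 (wordGrade β 1) := ∑ j, lift (f j) * TensorAlgebra.ι 𝕜 (x j) with ht
  have hδ : derivAction β t (0, 1) = (f, 0) := by
    have : ∀ j, derivAction β (lift (f j) * TensorAlgebra.ι 𝕜 (x j)) (0, 1) =
        (Finsupp.single j (f j), 0) := by
      intro j
      rw [map_mul, Module.End.mul_apply, derivAction_ι, smul_zero, zero_add, one_smul,
        derivAction_left, hlift, letterCoord_letterGen, Finsupp.smul_single, smul_eq_mul, mul_one]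
    rw [ht, map_sum, LinearMap.sum_apply, Finset.sum_congr rfl fun j _ => this j]
    ext1
    · rw [Prod.fst_sum]
      exact Finsupp.univ_sum_single f
    · rw [Prod.snd_sum]
      simp
  have hπ : t ∈ LinearMap.ker (canMap 𝕜 C (wordGrade β)).toLinearMap := by
    rw [LinearMap.mem_ker, AlgHom.toLinearMap_apply, ht, map_sum, ← h, letterEval,
      linearCombination_eq_sum]
    refine Finset.sum_congr rfl fun j _ => ?_
    rw [map_mul, hlift]
    simp [canMap, x]
  rw [hker] at hπ
  have hle : t ∈ (((Submodule.span C (Set.range r)).restrictScalars 𝕜).comap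
      (LinearMap.fst 𝕜 (X ⊕ Y →₀ C) 𝕜)).comap
        (((LinearMap.applyₗ ((0, 1) : (X ⊕ Y →₀ C) × 𝕜)) :
          Module.End 𝕜 ((X ⊕ Y →₀ C) × 𝕜) →ₗ[𝕜] _) ∘ₗ (derivAction β).toLinearMap) := by
    refine (Submodule.span_le.mpr ?_) hπ
    rintro _ ⟨c, d, s, ⟨hs, hs'⟩, rfl⟩
    change (derivAction β (c * s * d) (0, 1)).1 ∈ Submodule.span C (Set.range r)
    obtain ⟨g, hg, hg1, hg2⟩ := derivAction_degree_two hβ hs'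
    have hs0 : canMap 𝕜 C (wordGrade β) s = 0 := hs
    rw [hs0] at hg2
    obtain ⟨⟨e, a⟩, he⟩ : ∃ z, derivAction β d (0, 1) = z := ⟨_, rfl⟩
    rw [map_mul, map_mul, Module.End.mul_apply, Module.End.mul_apply, he,
      derivAction_apply s, hg, hs0, zero_smul, Prod.smul_mk, smul_zero, Prod.mk_add_mk, zero_add,
      add_zero, derivAction_left]
    rw [← algebraMap_smul C]
    exact Submodule.smul_mem _ _ (Submodule.smul_mem _ _
      (mem_span_relations_of_degree_one hβ hr hg1 hg2))
  change (derivAction β t (0, 1)).1 ∈ Submodule.span C (Set.range r) at hle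
  rwa [hδ] at hle

theorem relations_injective [Finite X] [Finite Y] (hβ : IsNormalWordBasis β)
    (hr : IsRelationFamily β r) (hq : IsQuadraticAlg 𝕜 C (wordGrade β)) :
    Function.Injective (Finsupp.linearCombination C r) := by
  classical
  have := Fintype.ofFinite X
  have := Fintype.ofFinite Y
  let Φ : (Y × X → C) →ₗ[𝕜] (Y × X → C) := LinearMap.pi fun i =>
    ∑ k, stripInr β i.1 ∘ₗ LinearMap.mulRight 𝕜 (r k (Sum.inl i.2)) ∘ₗ LinearMap.proj k
  have hΦ : ∀ x : Y × X →₀ C, ∀ i,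
      Φ x i = stripInr β i.1 (Finsupp.linearCombination C r x (Sum.inl i.2)) := by
    intro x i
    rw [linearCombination_eq_sum, Finsupp.finsetSum_apply, map_sum]
    simp [Φ]
  have hinj : Function.Injective Φ := by
    refine injective_of_surjective_of_projections (fun n => (gradeProj β n).compLeft (Y × X))
      (fun n => ?_) (fun x hx => ?_) Φ (fun n x => ?_) (fun m => ?_)
    · have := finiteDimensional_wordGrade β n
      refine Submodule.finiteDimensional_of_le
        (S₂ := LinearMap.range ((wordGrade β n).subtype.compLeft (Y × X))) ?_
      rintro _ ⟨x, rfl⟩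
      exact ⟨fun i => ⟨gradeProj β n (x i), gradeProj_mem β n (x i)⟩, rfl⟩
    · funext i
      exact eq_zero_of_gradeProj β fun n => congrFun (hx n) i
    · funext i
      simp only [Φ, LinearMap.pi_apply, LinearMap.sum_apply, LinearMap.compLeft_apply,
        LinearMap.comp_apply, LinearMap.proj_apply, map_sum, Function.comp_apply]
      refine Finset.sum_congr rfl fun k _ => ?_
      refine gradeProj_comm β (T := stripInr β i.1 ∘ₗ LinearMap.mulRight 𝕜 (r k (Sum.inl i.2)))
        (fun l c hc => ?_) n (x k)
      exact stripInr_mem β _ (hβ.mul_mem hc (hr.mem _ _))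
    · let y : X ⊕ Y →₀ C := ∑ i : Y × X,
        Finsupp.single (Sum.inl i.2) (m i * letterGen β (Sum.inr i.1))
      have hy : ∀ w v, stripInr β w (y (Sum.inl v)) = m (w, v) := by
        intro w v
        rw [Finsupp.finsetSum_apply, map_sum, Finset.sum_eq_single (w, v)]
        · simp [hβ.stripInr_mul]
        · rintro ⟨w', v'⟩ _ hne
          by_cases hv : v' = v
          · subst hv
            have hw : w' ≠ w := fun e => hne (by rw [e])
            simp [hβ.stripInr_mul, hw]
          · simp [hv]
        · simp
      obtain ⟨g, hg, hgy⟩ := hβ.exists_normalFamily y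
      have hmem := mem_span_relations hβ hr hq (f := y - g) (by rw [map_sub, hgy, sub_self])
      rw [← Finsupp.range_linearCombination] at hmem
      obtain ⟨x, hx⟩ := hmem
      refine ⟨x, funext fun i => ?_⟩
      rw [hΦ, hx, Finsupp.sub_apply, map_sub, hy, stripInr_of_mem_inlPart β i.1 (hg.1 i.2),
        sub_zero]
  intro x x' h
  refine DFunLike.coe_injective (hinj (funext fun i => ?_))
  rw [hΦ, hΦ, h]

theorem mem_freeGrade {𝒞 : ℕ → Submodule 𝕜 C} {i n : ℕ} {σ : Type} {x : σ →₀ C} :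
    x ∈ freeGrade 𝕜 C 𝒞 i σ n ↔ ∀ j, x j ∈ (if i ≤ n then 𝒞 (n - i) else ⊥) := by
  simp [freeGrade, Submodule.mem_iInf]

theorem linearCombination_mem_freeGrade (hβ : IsNormalWordBasis β) {i n : ℕ} {σ σ' : Type}
    {v : σ → (σ' →₀ C)} (hv : ∀ k j, v k j ∈ wordGrade β 1) {x : σ →₀ C}
    (hx : x ∈ freeGrade 𝕜 C (wordGrade β) (i + 1) σ n) :
    Finsupp.linearCombination C v x ∈ freeGrade 𝕜 C (wordGrade β) i σ' n := by
  rw [mem_freeGrade] at hx ⊢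
  intro j
  rw [Finsupp.linearCombination_apply, Finsupp.sum, Finsupp.finsetSum_apply]
  refine Submodule.sum_mem _ fun k _ => ?_
  rw [Finsupp.smul_apply, smul_eq_mul]
  have hk := hx k
  split_ifs at hk with hin
  · rw [if_pos (by omega), show n - i = n - (i + 1) + 1 by omega]
    exact hβ.mul_mem hk (hv k j)
  · rw [(Submodule.mem_bot 𝕜).mp hk, zero_mul]
    exact zero_mem _

theorem range_letterEval (hβ : IsNormalWordBasis β) :
    LinearMap.range (letterEval β) = augIdeal 𝕜 C (wordGrade β) := by
  apply le_antisymm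
  · rw [letterEval, Finsupp.range_linearCombination, Submodule.span_le]
    rintro _ ⟨j, rfl⟩
    exact Submodule.subset_span ⟨1, one_pos, letterGen_mem β j⟩
  · rw [augIdeal, Submodule.span_le]
    rintro c ⟨_ | n, hn, hc⟩
    · exact absurd hn (lt_irrefl _)
    · obtain ⟨g, _, hg⟩ := hβ.wordGrade_succ_le n hc
      exact ⟨g, hg⟩

/-- The generators of the terms of the resolution of the trivial module. -/
def resolutionIndex (X Y : Type) : ℕ → Type
  | 0 => Unit
  | 1 => X ⊕ Y
  | 2 => Y × X
  | _ + 3 => Empty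

/-- The augmentation of the resolution of the trivial module. -/
def resolutionAug (β : Basis (List X × List Y) 𝕜 C) :
    (Unit →₀ C) →ₗ[C] (C ⧸ augIdeal 𝕜 C (wordGrade β)) :=
  (augIdeal 𝕜 C (wordGrade β)).mkQ ∘ₗ Finsupp.lapply ()

/-- The first differential of the resolution of the trivial module. -/
def letterDiff (β : Basis (List X × List Y) 𝕜 C) : (X ⊕ Y →₀ C) →ₗ[C] (Unit →₀ C) :=
  Finsupp.linearCombination C fun j => Finsupp.single () (letterGen β j)

/-- The differentials of the resolution of the trivial module. -/
def resolutionDiff (β : Basis (List X × List Y) 𝕜 C) (r : Y × X → (X ⊕ Y →₀ C)) :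
    ∀ i : ℕ, (resolutionIndex X Y (i + 1) →₀ C) →ₗ[C] (resolutionIndex X Y i →₀ C)
  | 0 => letterDiff β
  | 1 => (Finsupp.linearCombination C r : (Y × X →₀ C) →ₗ[C] (X ⊕ Y →₀ C))
  | _ + 2 => 0

theorem letterDiff_apply (f : X ⊕ Y →₀ C) :
    letterDiff β f = Finsupp.single () (letterEval β f) := by
  rw [letterDiff, letterEval, Finsupp.linearCombination_apply, Finsupp.linearCombination_apply,
    Finsupp.sum, Finsupp.sum, Finsupp.single_finsetSum]
  simp

theorem resolutionAug_surjective (β : Basis (List X × List Y) 𝕜 C) :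
    Function.Surjective (resolutionAug β) := by
  intro y
  obtain ⟨c, rfl⟩ := Submodule.mkQ_surjective _ y
  exact ⟨Finsupp.single () c, by simp [resolutionAug]⟩

theorem ker_resolutionAug (hβ : IsNormalWordBasis β) :
    LinearMap.ker (resolutionAug β) = LinearMap.range (letterDiff β) := by
  ext x
  rw [resolutionAug, LinearMap.ker_comp, Submodule.ker_mkQ, Submodule.mem_comap,
    ← range_letterEval hβ]
  constructor
  · rintro ⟨f, hf⟩
    refine ⟨f, ?_⟩
    rw [letterDiff_apply, hf]
    exact Finsupp.ext fun _ => by simp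
  · rintro ⟨f, rfl⟩
    refine ⟨f, ?_⟩
    rw [letterDiff_apply]
    simp

theorem ker_letterDiff [Finite X] [Finite Y] (hβ : IsNormalWordBasis β)
    (hr : IsRelationFamily β r) (hq : IsQuadraticAlg 𝕜 C (wordGrade β)) :
    LinearMap.ker (letterDiff β) = LinearMap.range (Finsupp.linearCombination C r) := by
  ext f
  rw [LinearMap.mem_ker, letterDiff_apply, Finsupp.range_linearCombination, Finsupp.single_eq_zero]
  constructor
  · exact mem_span_relations hβ hr hq
  · intro h
    have hle : Submodule.span C (Set.range r) ≤ LinearMap.ker (letterEval β) := by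
      rw [Submodule.span_le]
      rintro _ ⟨i, rfl⟩
      exact hr.letterEval_eq_zero i
    exact hle h

theorem resolutionAug_eq_zero {n : ℕ} (hn : 0 < n) {x : Unit →₀ C}
    (hx : x ∈ freeGrade 𝕜 C (wordGrade β) 0 Unit n) : resolutionAug β x = 0 := by
  rw [resolutionAug, LinearMap.comp_apply, Submodule.mkQ_apply, Submodule.Quotient.mk_eq_zero]
  have := mem_freeGrade.mp hx ()
  rw [if_pos (Nat.zero_le _)] at this
  exact Submodule.subset_span ⟨n, hn, this⟩

theorem isKoszul_of_isNormalWordBasis [Finite X] [Finite Y] (hβ : IsNormalWordBasis β)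
    (hq : IsQuadraticAlg 𝕜 C (wordGrade β)) : IsKoszul 𝕜 C (wordGrade β) := by
  obtain ⟨r, hr⟩ := hβ.exists_isRelationFamily
  refine ⟨resolutionIndex X Y, resolutionDiff β r, resolutionAug β, resolutionAug_surjective β,
    ker_resolutionAug hβ, ?_, ?_, fun n hn x hx => resolutionAug_eq_zero hn hx⟩
  · rintro (_ | _ | i)
    · exact ker_letterDiff hβ hr hq
    · change LinearMap.ker (Finsupp.linearCombination C r) = LinearMap.range 0
      rw [LinearMap.range_zero, LinearMap.ker_eq_bot]
      exact relations_injective hβ hr hq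
    · have : Subsingleton (resolutionIndex X Y (i + 1 + 1 + 1) →₀ C) :=
        inferInstanceAs (Subsingleton (Empty →₀ C))
      exact Subsingleton.elim _ _
  · rintro (_ | _ | i) n x hx
    · have hmem : ∀ (k : X ⊕ Y) (j : Unit),
          (Finsupp.single () (letterGen β k) : Unit →₀ C) j ∈ wordGrade β 1 := by
        intro k j
        rw [Finsupp.single_eq_same]
        exact letterGen_mem β k
      exact linearCombination_mem_freeGrade hβ hmem hx
    · exact linearCombination_mem_freeGrade hβ hr.mem hx
    · exact zero_mem _

end NormalWords

section TensorWords

variable {𝕜 V : Type} [Field 𝕜] [AddCommGroup V] [Module 𝕜 V] {X : Type}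

/-- The basis of words of the tensor algebra; words are written from right to left. -/
def tensorWordBasis (b : Basis X 𝕜 V) : Basis (List X) 𝕜 (TensorAlgebra 𝕜 V) :=
  b.tensorAlgebra.reindex
    (FreeMonoid.toList.trans ⟨List.reverse, List.reverse, List.reverse_reverse,
      List.reverse_reverse⟩)

variable (b : Basis X 𝕜 V)

theorem tensorWordBasis_apply (p : List X) :
    tensorWordBasis b p = (p.reverse.map fun x => TensorAlgebra.ι 𝕜 (b x)).prod := by
  have : tensorWordBasis b p = (TensorAlgebra.equivFreeAlgebra b).symm
      (FreeAlgebra.basisFreeMonoid 𝕜 X (FreeMonoid.ofList p.reverse)) := by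
    simp [tensorWordBasis, Module.Basis.tensorAlgebra]
  rw [this]
  have h2 : ∀ l : List X, FreeAlgebra.basisFreeMonoid 𝕜 X (FreeMonoid.ofList l) =
      (l.map (FreeAlgebra.ι 𝕜)).prod := by
    intro l
    rw [FreeAlgebra.basisFreeMonoid, Basis.map_apply, Finsupp.coe_basisSingleOne]
    simp [FreeAlgebra.equivMonoidAlgebraFreeMonoid, MonoidAlgebra.lift_apply]
  rw [h2, map_list_prod]
  simp [Function.comp_def]

theorem tensorWordBasis_nil : tensorWordBasis b [] = 1 := by
  simp [tensorWordBasis_apply]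

theorem tensorWordBasis_cons (x : X) (p : List X) :
    tensorWordBasis b (x :: p) = tensorWordBasis b p * TensorAlgebra.ι 𝕜 (b x) := by
  simp [tensorWordBasis_apply]

theorem tensorWordBasis_singleton (x : X) :
    tensorWordBasis b [x] = TensorAlgebra.ι 𝕜 (b x) := by
  simp [tensorWordBasis_apply]

theorem tensorWeight_eq_span (n : ℕ) :
    tensorWeight 𝕜 V n = Submodule.span 𝕜 (tensorWordBasis b '' {p | p.length = n}) := by
  induction n with
  | zero =>
    have : {p : List X | p.length = 0} = {[]} := by ext; simp
    rw [this, Set.image_singleton, tensorWordBasis_nil, tensorWeight, pow_zero,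
      Submodule.one_eq_span]
  | succ n ih =>
    have hι : LinearMap.range (TensorAlgebra.ι 𝕜 (M := V)) =
        Submodule.span 𝕜 (Set.range fun x => TensorAlgebra.ι 𝕜 (b x)) := by
      rw [LinearMap.range_eq_map, ← b.span_eq, Submodule.map_span, ← Set.range_comp]
      rfl
    rw [tensorWeight, pow_succ, ← tensorWeight, ih, hι, Submodule.span_mul_span]
    congr 1
    ext t
    constructor
    · rintro ⟨_, ⟨p, hp, rfl⟩, _, ⟨x, rfl⟩, rfl⟩
      exact ⟨x :: p, by simpa using hp, tensorWordBasis_cons b x p⟩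
    · rintro ⟨_ | ⟨x, p⟩, hp, rfl⟩
      · simp at hp
      · exact ⟨_, ⟨p, by simpa using hp, rfl⟩, _, ⟨x, rfl⟩, (tensorWordBasis_cons b x p).symm⟩

variable {W : Type} [AddCommGroup W] [Module 𝕜 W] {Y : Type} (b' : Basis Y 𝕜 W)

theorem kunneth_tensorWeight_eq_span (n : ℕ) :
    kunneth 𝕜 (tensorWeight 𝕜 V) (tensorWeight 𝕜 W) n =
      Submodule.span 𝕜 (((tensorWordBasis b).tensorProduct (tensorWordBasis b')) ''
        {s | s.1.length + s.2.length = n}) := by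
  apply le_antisymm
  · refine iSup₂_le fun ij hij => ?_
    rw [subTmul, TensorProduct.range_map_eq_span_tmul, Submodule.span_le]
    rintro _ ⟨⟨x, hx⟩, ⟨y, hy⟩, rfl⟩
    simp only [Submodule.subtype_apply]
    rw [tensorWeight_eq_span b] at hx
    rw [tensorWeight_eq_span b'] at hy
    have := Submodule.apply_mem_map₂ (TensorProduct.mk 𝕜 _ _) hx hy
    rw [Submodule.map₂_span_span] at this
    refine Submodule.span_mono ?_ this
    rintro _ ⟨_, ⟨p, hp, rfl⟩, _, ⟨q, hq, rfl⟩, rfl⟩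
    refine ⟨(p, q), ?_, by simp [Basis.tensorProduct_apply]⟩
    simp only [Set.mem_ofPred_eq] at hp hq ⊢
    omega
  · rw [Submodule.span_le]
    rintro _ ⟨⟨p, q⟩, h, rfl⟩
    refine Submodule.mem_iSup_of_mem (p.length, q.length) (Submodule.mem_iSup_of_mem h ?_)
    rw [Basis.tensorProduct_apply]
    refine ⟨⟨_, ?_⟩ ⊗ₜ ⟨_, ?_⟩, TensorProduct.map_tmul _ _ _ _⟩
    · rw [tensorWeight_eq_span b]
      exact Submodule.subset_span ⟨p, rfl, rfl⟩
    · rw [tensorWeight_eq_span b']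
      exact Submodule.subset_span ⟨q, rfl, rfl⟩

end TensorWords

section Twisted

variable {𝕜 A B C : Type} [Field 𝕜] [Ring A] [Algebra 𝕜 A] [Ring B] [Algebra 𝕜 B] [Ring C]
  [Algebra 𝕜 C] {τ : B ⊗[𝕜] A →ₗ[𝕜] A ⊗[𝕜] B} {ψ : A ⊗[𝕜] B →ₗ[𝕜] C}

theorem mulTau_tmul (a a' : A) (b b' : B) :
    mulTau 𝕜 A B τ ((a ⊗ₜ b) ⊗ₜ (a' ⊗ₜ b')) =
      TensorProduct.map (LinearMap.mulLeft 𝕜 a) (LinearMap.mulRight 𝕜 b') (τ (b ⊗ₜ a')) := by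
  simp only [mulTau, LinearMap.comp_apply, LinearEquiv.coe_coe, TensorProduct.assoc_tmul,
    LinearMap.lTensor_tmul, TensorProduct.assoc_symm_tmul, LinearMap.rTensor_tmul]
  generalize τ (b ⊗ₜ a') = z
  induction z with
  | zero => simp
  | tmul x y => simp
  | add x y hx hy => simp only [TensorProduct.add_tmul, TensorProduct.tmul_add, map_add, hx, hy]

theorem Realizes.mul_tmul_right (h : Realizes 𝕜 A B τ C ψ) (hτ : IsTwisting 𝕜 A B τ) (a : A)
    (b b' : B) : ψ (a ⊗ₜ b) * ψ (1 ⊗ₜ b') = ψ (a ⊗ₜ (b * b')) := by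
  rw [← h.2.2, mulTau_tmul, hτ.2.1]
  simp

theorem Realizes.mul_tmul_left (h : Realizes 𝕜 A B τ C ψ) (hτ : IsTwisting 𝕜 A B τ) (a a' : A) :
    ψ (a ⊗ₜ 1) * ψ (a' ⊗ₜ 1) = ψ ((a * a') ⊗ₜ 1) := by
  rw [← h.2.2, mulTau_tmul, hτ.1]
  simp

end Twisted


section TwistedTensorAlgebras

variable {𝕜 V W : Type} [Field 𝕜] [AddCommGroup V] [Module 𝕜 V] [AddCommGroup W] [Module 𝕜 W]
  {X Y : Type} (b : Basis X 𝕜 V) (b' : Basis Y 𝕜 W) {C : Type} [Ring C] [Algebra 𝕜 C]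
  {τ : TensorAlgebra 𝕜 W ⊗[𝕜] TensorAlgebra 𝕜 V →ₗ[𝕜] TensorAlgebra 𝕜 V ⊗[𝕜] TensorAlgebra 𝕜 W}
  {ψ : TensorAlgebra 𝕜 V ⊗[𝕜] TensorAlgebra 𝕜 W →ₗ[𝕜] C}

/-- The basis of an algebra realizing a twisted tensor product of tensor algebras formed by the
images of the tensors of words. -/
def realizedWordBasis (hψ : Function.Bijective ψ) : Basis (List X × List Y) 𝕜 C :=
  ((tensorWordBasis b).tensorProduct (tensorWordBasis b')).map (LinearEquiv.ofBijective ψ hψ)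

theorem realizedWordBasis_apply (hψ : Function.Bijective ψ) (p : List X) (q : List Y) :
    realizedWordBasis b b' hψ (p, q) = ψ (tensorWordBasis b p ⊗ₜ tensorWordBasis b' q) := by
  simp [realizedWordBasis, Basis.tensorProduct_apply]

theorem map_kunneth_tensorWeight (hψ : Function.Bijective ψ) (n : ℕ) :
    Submodule.map ψ (kunneth 𝕜 (tensorWeight 𝕜 V) (tensorWeight 𝕜 W) n) =
      wordGrade (realizedWordBasis b b' hψ) n := by
  rw [kunneth_tensorWeight_eq_span b b', Submodule.map_span, Set.image_image]
  rfl

theorem isNormalWordBasis_realizedWordBasis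
    (hτ : IsGradedTwisting 𝕜 (TensorAlgebra 𝕜 V) (TensorAlgebra 𝕜 W)
      (tensorWeight 𝕜 V) (tensorWeight 𝕜 W) τ)
    (h : Realizes 𝕜 (TensorAlgebra 𝕜 V) (TensorAlgebra 𝕜 W) τ C ψ) :
    IsNormalWordBasis (realizedWordBasis b b' h.1) where
  nil := by
    rw [realizedWordBasis_apply, tensorWordBasis_nil, tensorWordBasis_nil, h.2.1]
  mul_inr p q w := by
    rw [letterGen, realizedWordBasis_apply, realizedWordBasis_apply, realizedWordBasis_apply,
      tensorWordBasis_nil, h.mul_tmul_right hτ.1, tensorWordBasis_singleton, tensorWordBasis_cons]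
  mul_inl p v := by
    rw [letterGen, realizedWordBasis_apply, realizedWordBasis_apply, realizedWordBasis_apply,
      tensorWordBasis_nil, h.mul_tmul_left hτ.1, tensorWordBasis_singleton, tensorWordBasis_cons]
  mul_inl_mem p q v := by
    rw [letterGen, realizedWordBasis_apply, realizedWordBasis_apply, ← h.2.2, mulTau_tmul]
    have hmem : τ (tensorWordBasis b' q ⊗ₜ tensorWordBasis b [v]) ∈
        kunneth 𝕜 (tensorWeight 𝕜 V) (tensorWeight 𝕜 W) (q.length + 1) := by
      refine hτ.2 _ (Submodule.mem_map_of_mem ?_)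
      rw [kunneth_tensorWeight_eq_span b' b]
      exact Submodule.subset_span ⟨(q, [v]), rfl, Basis.tensorProduct_apply _ _ _ _⟩
    rw [kunneth_tensorWeight_eq_span b b'] at hmem
    generalize τ (tensorWordBasis b' q ⊗ₜ tensorWordBasis b [v]) = t at hmem
    induction hmem using Submodule.span_induction with
    | mem x hx =>
      obtain ⟨⟨p', q'⟩, hl, rfl⟩ := hx
      have hp : tensorWordBasis b p * tensorWordBasis b p' = tensorWordBasis b (p' ++ p) := by
        simp [tensorWordBasis_apply]
      rw [Basis.tensorProduct_apply, TensorProduct.map_tmul, LinearMap.mulLeft_apply,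
        LinearMap.mulRight_apply, hp, tensorWordBasis_nil, mul_one, ← realizedWordBasis_apply]
      refine basis_mem_wordGrade _ _ ?_
      simp only [Set.mem_ofPred_eq] at hl
      simp only [List.length_append]
      omega
    | zero => simp
    | add x y _ _ hx hy => simpa only [map_add] using add_mem hx hy
    | smul c x _ hx => simpa only [map_smul] using Submodule.smul_mem _ c hx

end TwistedTensorAlgebras

/-- Proposition 5.5 (`freeKoszul`).  If `A` and `B` are free algebras generated in
degree 1 (tensor algebras on finite-dimensional spaces) and `τ : B ⊗ A → A ⊗ B` is a
graded twisting map such that the twisted tensor product `A ⊗_τ B` is quadratic, then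
`A ⊗_τ B` is a Koszul algebra.  (The twisted tensor product is encoded through
realizations `(C, ψ)` of `(A ⊗ B, μ_τ)`, with the transported Künneth grading.) -/
theorem stmt11 (𝕜 : Type) [Field 𝕜] (V W : Type)
    [AddCommGroup V] [Module 𝕜 V] [AddCommGroup W] [Module 𝕜 W]
    [FiniteDimensional 𝕜 V] [FiniteDimensional 𝕜 W]
    (τ : (TensorAlgebra 𝕜 W) ⊗[𝕜] (TensorAlgebra 𝕜 V) →ₗ[𝕜]
      (TensorAlgebra 𝕜 V) ⊗[𝕜] (TensorAlgebra 𝕜 W))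
    (hτ : IsGradedTwisting 𝕜 (TensorAlgebra 𝕜 V) (TensorAlgebra 𝕜 W)
      (tensorWeight 𝕜 V) (tensorWeight 𝕜 W) τ) :
    ∀ (C : Type) [Ring C] [Algebra 𝕜 C],
      ∀ ψ : (TensorAlgebra 𝕜 V) ⊗[𝕜] (TensorAlgebra 𝕜 W) →ₗ[𝕜] C,
        Realizes 𝕜 (TensorAlgebra 𝕜 V) (TensorAlgebra 𝕜 W) τ C ψ →
        IsQuadraticAlg 𝕜 C
          (fun n => Submodule.map ψ (kunneth 𝕜 (tensorWeight 𝕜 V) (tensorWeight 𝕜 W) n)) →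
        IsKoszul 𝕜 C
          (fun n => Submodule.map ψ (kunneth 𝕜 (tensorWeight 𝕜 V) (tensorWeight 𝕜 W) n)) := by
  intro C _ _ ψ h hq
  have hgrade := funext
    (map_kunneth_tensorWeight (Module.finBasis 𝕜 V) (Module.finBasis 𝕜 W) h.1)
  rw [hgrade] at hq ⊢
  exact isKoszul_of_isNormalWordBasis (isNormalWordBasis_realizedWordBasis _ _ hτ h) hq

end TTP
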